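/- Let n ≥ 1, let Ω = I_n ⊗ [[0,1],[-1,0]], let S be a real symplectic 2n×2n matrix, let ν₁,…,ν_n be reals with each ν_j > 1, let D := diag(ν₁,…,ν_n) ⊗ I₂, E := diag(√(1-ν₁⁻²),…,√(1-ν_n⁻²)) ⊗ I₂, V := SᵀDS and R := Sᵀ E S⁻ᵀ. Let V₀ be a real symmetric 2n×2n matrix such that the complex Hermitian matrix V₀ + iΩ is positive definite and V − V₀ is positive definite. Define the real symmetric matrix V₄ := −V + R V (V − V₀)⁻¹ V Rᵀ. Then the complex Hermitian matrix V₄ + iΩ is positive definite. -/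

import Mathlib

open Matrix
open scoped Kronecker ComplexOrder

noncomputable section

/-- The `2n × 2n` standard symplectic form `Ω = I_n ⊗ [[0,1],[-1,0]]`. -/
def Omega (n : ℕ) : Matrix (Fin n × Fin 2) (Fin n × Fin 2) ℝ :=
  (1 : Matrix (Fin n) (Fin n) ℝ) ⊗ₖ !![(0 : ℝ), 1; -1, 0]

/-- Complexification of a real `2n × 2n` matrix. -/
def cmat {n : ℕ} (M : Matrix (Fin n × Fin 2) (Fin n × Fin 2) ℝ) :
    Matrix (Fin n × Fin 2) (Fin n × Fin 2) ℂ :=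
  M.map Complex.ofReal

section Auxiliary

open scoped MatrixOrder

variable {m : Type*} [Fintype m] [DecidableEq m]

/-- Inversion is strictly antitone on positive definite matrices. -/
lemma posDef_inv_sub_inv {A B : Matrix m m ℂ} (hA : A.PosDef) (hBA : (B - A).PosDef) :
    (A⁻¹ - B⁻¹).PosDef := by
  have hB : B.PosDef := by simpa using hA.add hBA
  have hAu : IsUnit A.det := (isUnit_iff_isUnit_det A).1 hA.isUnit
  have hBu : IsUnit B.det := (isUnit_iff_isUnit_det B).1 hB.isUnit
  have hsum : ((B - A) + (B - A) * A⁻¹ * (B - A)).PosDef := by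
    refine hBA.add_posSemidef ?_
    have h := hA.inv.posSemidef.conjTranspose_mul_mul_same (B - A)
    rwa [hBA.isHermitian.eq] at h
  refine (IsUnit.posDef_star_left_conjugate_iff hB.isUnit).1 ?_
  have hstar : star B = B := hB.isHermitian.eq
  have h : star B * (A⁻¹ - B⁻¹) * B = (B - A) + (B - A) * A⁻¹ * (B - A) := by
    rw [hstar]
    simp only [mul_sub, sub_mul, mul_assoc, nonsing_inv_mul _ hAu, nonsing_inv_mul _ hBu,
      mul_one, mul_nonsing_inv_cancel_left _ _ hAu]
    abel
  rwa [h]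

/-- The complexification of a real positive definite matrix is positive definite. -/
lemma posDef_map_ofReal {A : Matrix m m ℝ} (hA : A.PosDef) :
    (A.map Complex.ofReal).PosDef := by
  obtain ⟨B, hB⟩ := CStarAlgebra.nonneg_iff_eq_star_mul_self.1
    (Matrix.nonneg_iff_posSemidef.2 hA.posSemidef)
  have hmap : A.map Complex.ofReal = (B.map Complex.ofReal)ᴴ * B.map Complex.ofReal := by
    ext i j
    simp [hB, Matrix.mul_apply, star_eq_conjTranspose]
  have hunit : IsUnit (A.map Complex.ofReal) := hA.isUnit.map Complex.ofRealHom.mapMatrix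
  refine Matrix.PosSemidef.posDef_iff_isUnit ?_ |>.2 hunit
  rw [hmap]
  exact posSemidef_conjTranspose_mul_self _

/-- If `x` and `y` are congruent to `a` and `b`, where `a` commutes with an invertible `p` such
that `b * a = p * p`, then `q * x⁻¹ * q = y` for the corresponding congruence `q` of `p`. -/
lemma congr_mul_inv_mul_congr {s t a b p : Matrix m m ℂ} (hs : IsUnit s) (ht : IsUnit t)
    (hp : IsUnit p) (hcomm : p * a = a * p) (hba : b * a = p * p) :
    (t * p * s) * (t * a * s)⁻¹ * (t * p * s) = t * b * s := by
  have hsu : IsUnit s.det := (isUnit_iff_isUnit_det s).1 hs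
  have htu : IsUnit t.det := (isUnit_iff_isUnit_det t).1 ht
  have ha : IsUnit a.det := by
    have h : IsUnit (b * a).det := (isUnit_iff_isUnit_det _).1 (hba ▸ hp.mul hp)
    rw [det_mul] at h
    exact isUnit_of_mul_isUnit_right h
  have hpa : a⁻¹ * p = p * a⁻¹ := by
    calc a⁻¹ * p = a⁻¹ * (p * a) * a⁻¹ := by
          rw [mul_assoc, mul_assoc, mul_nonsing_inv _ ha, mul_one]
      _ = p * a⁻¹ := by rw [hcomm, nonsing_inv_mul_cancel_left _ _ ha]
  have hb : p * (a⁻¹ * p) = b := by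
    rw [hpa, ← mul_assoc, ← hba, mul_assoc, mul_nonsing_inv _ ha, mul_one]
  simp only [Matrix.mul_inv_rev, mul_assoc, mul_nonsing_inv_cancel_left _ _ hsu,
    nonsing_inv_mul_cancel_left _ _ htu]
  rw [← hb]
  simp only [mul_assoc]

end Auxiliary

section Complexification

variable {n : ℕ} (M N : Matrix (Fin n × Fin 2) (Fin n × Fin 2) ℝ)

lemma cmat_mul : cmat (M * N) = cmat M * cmat N :=
  map_mul Complex.ofRealHom.mapMatrix M N

lemma cmat_add : cmat (M + N) = cmat M + cmat N :=
  map_add Complex.ofRealHom.mapMatrix M N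

lemma cmat_sub : cmat (M - N) = cmat M - cmat N :=
  map_sub Complex.ofRealHom.mapMatrix M N

lemma cmat_neg : cmat (-M) = -cmat M :=
  map_neg Complex.ofRealHom.mapMatrix M

lemma cmat_one : cmat (1 : Matrix (Fin n × Fin 2) (Fin n × Fin 2) ℝ) = 1 :=
  map_one Complex.ofRealHom.mapMatrix

variable {M}

lemma isUnit_cmat (hM : IsUnit M) : IsUnit (cmat M) :=
  hM.map Complex.ofRealHom.mapMatrix

lemma cmat_inv (hM : IsUnit M) : cmat M⁻¹ = (cmat M)⁻¹ := by
  refine (inv_eq_left_inv ?_).symm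
  rw [← cmat_mul, nonsing_inv_mul _ ((isUnit_iff_isUnit_det M).1 hM), cmat_one]

lemma star_cmat_of_isSymm (hM : M.IsSymm) : star (cmat M) = cmat M := by
  ext i j
  simp [cmat, hM.apply]

end Complexification

lemma Omega_mul_Omega (n : ℕ) : Omega n * Omega n = -1 := by
  have h : (!![(0 : ℝ), 1; -1, 0] * !![(0 : ℝ), 1; -1, 0]) = (-1 : ℝ) • 1 := by
    ext i j
    fin_cases i <;> fin_cases j <;> simp
  rw [Omega, ← mul_kronecker_mul, h, kronecker_smul, mul_one, one_kronecker_one, neg_one_smul]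

lemma isUnit_of_transpose_mul_Omega_mul {n : ℕ} {S : Matrix (Fin n × Fin 2) (Fin n × Fin 2) ℝ}
    (hS : Sᵀ * Omega n * S = Omega n) : IsUnit S := by
  have h : (-(Omega n * Sᵀ * Omega n)) * S = 1 := by
    rw [neg_mul, mul_assoc, mul_assoc, ← mul_assoc Sᵀ, hS, Omega_mul_Omega, neg_neg]
  exact IsUnit.of_mul_eq_one_right _ h

lemma diagonal_kronecker_one_mul_Omega {n : ℕ} (f : Fin n → ℝ) :
    (diagonal f ⊗ₖ (1 : Matrix (Fin 2) (Fin 2) ℝ)) * Omega n =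
      Omega n * (diagonal f ⊗ₖ (1 : Matrix (Fin 2) (Fin 2) ℝ)) := by
  simp only [Omega, ← mul_kronecker_mul, mul_one, one_mul]

/-- With `V = SᵀDS` in Williamson form, `R = √(I + (VΩ)⁻²)`, and `V₀` real symmetric
with `V₀ + iΩ` and `V − V₀` positive definite, the matrix
`V₄ := −V + R V (V − V₀)⁻¹ V Rᵀ` satisfies `V₄ + iΩ > 0`. -/
theorem V4_plus_iOmega_posDef (n : ℕ) (hn : 1 ≤ n)
    (S : Matrix (Fin n × Fin 2) (Fin n × Fin 2) ℝ)
    (hS : Sᵀ * Omega n * S = Omega n)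
    (ν : Fin n → ℝ) (hν : ∀ j, 1 < ν j)
    (D E V R : Matrix (Fin n × Fin 2) (Fin n × Fin 2) ℝ)
    (hD : D = (Matrix.diagonal ν) ⊗ₖ (1 : Matrix (Fin 2) (Fin 2) ℝ))
    (hE : E = (Matrix.diagonal fun j => Real.sqrt (1 - ((ν j) ^ 2)⁻¹)) ⊗ₖ
      (1 : Matrix (Fin 2) (Fin 2) ℝ))
    (hV : V = Sᵀ * D * S)
    (hR : R = Sᵀ * E * (S⁻¹)ᵀ)
    (V₀ : Matrix (Fin n × Fin 2) (Fin n × Fin 2) ℝ) (hV₀symm : V₀.IsSymm)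
    (hV₀ : (cmat V₀ + Complex.I • cmat (Omega n)).PosDef)
    (hVV₀ : (V - V₀).PosDef)
    (V₄ : Matrix (Fin n × Fin 2) (Fin n × Fin 2) ℝ)
    (hV₄ : V₄ = -V + R * V * (V - V₀)⁻¹ * V * Rᵀ) :
    (cmat V₄ + Complex.I • cmat (Omega n)).PosDef := by
  have hSu : IsUnit S := isUnit_of_transpose_mul_Omega_mul hS
  have hSdet : IsUnit S.det := (isUnit_iff_isUnit_det S).1 hSu
  have hStu : IsUnit Sᵀ := (isUnit_transpose S).2 hSu
  let f : Fin n → ℝ := fun j => Real.sqrt (1 - ((ν j) ^ 2)⁻¹) * ν j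
  have hf : ∀ j, f j * f j = ν j * ν j - 1 := fun j => by
    have hj := hν j
    have hle : ((ν j) ^ 2)⁻¹ ≤ 1 := inv_le_one_of_one_le₀ (by nlinarith)
    have hsq := Real.mul_self_sqrt (sub_nonneg.2 hle)
    calc f j * f j
        = Real.sqrt (1 - ((ν j) ^ 2)⁻¹) * Real.sqrt (1 - ((ν j) ^ 2)⁻¹) * (ν j * ν j) := by
          simp only [f]; ring
      _ = ν j * ν j - 1 := by
          rw [hsq]
          have : ν j ≠ 0 := by positivity
          field_simp
  set P := E * D with hP
  have hPf : P = diagonal f ⊗ₖ (1 : Matrix (Fin 2) (Fin 2) ℝ) := by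
    rw [hP, hD, hE, ← mul_kronecker_mul, diagonal_mul_diagonal, one_mul]
  have hDE : D * E = P := by
    rw [hP, hD, hE, ← mul_kronecker_mul, ← mul_kronecker_mul, diagonal_mul_diagonal,
      diagonal_mul_diagonal]
    simp only [mul_comm]
  have hPP : P * P = D * D - 1 := by
    rw [eq_sub_iff_add_eq, hPf, hD, ← mul_kronecker_mul, ← mul_kronecker_mul,
      diagonal_mul_diagonal, diagonal_mul_diagonal, mul_one, ← one_kronecker_one,
      ← diagonal_one (n := Fin n), ← add_kronecker, diagonal_add]
    simp only [hf, sub_add_cancel]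
  have hPu : IsUnit P := by
    have hne : ∀ j, f j ≠ 0 := fun j h => by
      have h1 := hf j
      have h2 := hν j
      rw [h] at h1
      nlinarith
    refine IsUnit.of_mul_eq_one (diagonal (fun j => (f j)⁻¹) ⊗ₖ 1) ?_
    rw [hPf, ← mul_kronecker_mul, diagonal_mul_diagonal, mul_one]
    simp [hne]
  have hPD : P * D = D * P := by rw [← hDE, mul_assoc, ← hP, hDE]
  have hDΩ : D * Omega n = Omega n * D := hD ▸ diagonal_kronecker_one_mul_Omega ν
  have hPΩ : P * Omega n = Omega n * P := hPf ▸ diagonal_kronecker_one_mul_Omega f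
  have hDt : Dᵀ = D := by rw [hD, ← kroneckerMap_transpose]; simp
  have hEt : Eᵀ = E := by rw [hE, ← kroneckerMap_transpose]; simp
  have hRV : R * V = Sᵀ * P * S := by
    rw [hR, hV, hP, transpose_nonsing_inv]
    simp only [mul_assoc,
      nonsing_inv_mul_cancel_left _ _ ((isUnit_iff_isUnit_det Sᵀ).1 hStu)]
  have hVR : V * Rᵀ = Sᵀ * P * S := by
    rw [hR, hV, ← hDE]
    simp only [transpose_mul, transpose_transpose, hEt, mul_assoc,
      mul_nonsing_inv_cancel_left _ _ hSdet]
  have hQsymm : (Sᵀ * P * S).IsSymm := by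
    simp only [IsSymm, transpose_mul, transpose_transpose, hP, hDt, hEt, hDE, mul_assoc]
  set Q := Sᵀ * P * S with hQ
  have hB : cmat V + Complex.I • cmat (Omega n)
      = cmat Sᵀ * (cmat D + Complex.I • cmat (Omega n)) * cmat S := by
    conv_lhs => rw [hV, ← hS]
    simp only [cmat_mul, mul_add, add_mul, mul_smul_comm, smul_mul_assoc]
  have hB' : cmat V - Complex.I • cmat (Omega n)
      = cmat Sᵀ * (cmat D - Complex.I • cmat (Omega n)) * cmat S := by
    conv_lhs => rw [hV, ← hS]
    simp only [cmat_mul, mul_sub, sub_mul, mul_smul_comm, smul_mul_assoc]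
  have hkey : cmat Q * (cmat V + Complex.I • cmat (Omega n))⁻¹ * cmat Q
      = cmat V - Complex.I • cmat (Omega n) := by
    rw [hB, hB', hQ, cmat_mul, cmat_mul]
    refine congr_mul_inv_mul_congr (isUnit_cmat hSu) (isUnit_cmat hStu) (isUnit_cmat hPu) ?_ ?_
    · simp only [mul_add, add_mul, mul_smul_comm, smul_mul_assoc, ← cmat_mul, hPD, hPΩ]
    · simp only [mul_add, sub_mul, mul_smul_comm, smul_mul_assoc, ← cmat_mul, hDΩ, hPP,
        Omega_mul_Omega, smul_smul, smul_sub, Complex.I_mul_I, cmat_sub, cmat_neg, cmat_one]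
      simp
  have hXu : IsUnit (V - V₀) := hVV₀.isUnit
  have hfinal : cmat V₄ + Complex.I • cmat (Omega n) = star (cmat Q) *
      ((cmat (V - V₀))⁻¹ - (cmat V + Complex.I • cmat (Omega n))⁻¹) * cmat Q := by
    rw [star_cmat_of_isSymm hQsymm, mul_sub, sub_mul, hkey, hV₄, mul_assoc _ V Rᵀ, hVR, hRV,
      cmat_add, cmat_neg, cmat_mul, cmat_mul, cmat_inv hXu]
    abel
  have hQu : IsUnit (cmat Q) := isUnit_cmat ((hStu.mul hPu).mul hSu)
  rw [hfinal]
  refine (IsUnit.posDef_star_left_conjugate_iff hQu).2 (posDef_inv_sub_inv ?_ ?_)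
  · exact posDef_map_ofReal hVV₀
  · have h : cmat V + Complex.I • cmat (Omega n) - cmat (V - V₀)
        = cmat V₀ + Complex.I • cmat (Omega n) := by
      rw [cmat_sub]
      abel
    rwa [h]

end
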